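/- Let (R, 𝔪) be a Noetherian local ring of dimension 1, and let 𝔮 = (x) be a standard parameter ideal of R such that 𝒩(𝔮;R) = r₀(R) + r₁(R). Then 𝔮^{n+1} :_R 𝔪 = 𝔮ⁿ(𝔮 :_R 𝔪) + ((0) :_R 𝔪) for all n ≥ 0. -/

import Mathlib

open CategoryTheory IsLocalRing

noncomputable section

/-- The length of a module, defined as the Krull dimension of its submodule lattice. -/
def moduleLength (R M : Type) [CommRing R] [AddCommGroup M] [Module R M] : WithBot ℕ∞ :=
  Order.krullDim (Submodule R M)

variable (R : Type) [CommRing R] [IsLocalRing R]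

/-- `q` is a parameter ideal of the `d`-dimensional local ring `R`:
it is generated by `d` elements and is `𝔪`-primary (its radical is `𝔪`). -/
def IsParameterIdeal (d : ℕ) (q : Ideal R) : Prop :=
  (∃ x : Fin d → R, q = Ideal.span (Set.range x)) ∧ q.radical = maximalIdeal R

/-- `e` is the sequence of Hilbert coefficients of the `𝔪`-primary ideal `I`:
for all large `n`, `ℓ(R/Iⁿ⁺¹) = Σ_{i=0}^d (-1)^i e_i C(n+d-i, d-i)`. -/
def IsHilbertCoeffs (d : ℕ) (I : Ideal R) (e : ℕ → ℤ) : Prop :=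
  ∃ N : ℕ, ∀ n ≥ N, ∃ L : ℕ,
    moduleLength R (R ⧸ I ^ (n + 1)) = (L : ℕ∞) ∧
    (L : ℤ) = ∑ i ∈ Finset.range (d + 1),
      (-1 : ℤ) ^ i * e i * ((n + d - i).choose (d - i) : ℤ)

/-- The index of reducibility `𝒩(q;R) = ℓ_R((q :_R 𝔪)/q)`. -/
def indexOfReducibility (q : Ideal R) : WithBot ℕ∞ :=
  moduleLength R
    (↥(q.colon (maximalIdeal R)) ⧸ (Submodule.comap (q.colon (maximalIdeal R)).subtype q))

/-- `R` is unmixed of dimension `d`: `dim (R̂/P) = d` for every associated prime `P`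
of the `𝔪`-adic completion `R̂` of `R`. -/
def IsUnmixed (d : ℕ) : Prop :=
  ∀ P ∈ associatedPrimes (AdicCompletion (maximalIdeal R) R) (AdicCompletion (maximalIdeal R) R),
    ringKrullDim ((AdicCompletion (maximalIdeal R) R) ⧸ P) = (d : WithBot ℕ∞)

/-- The depth of a local ring `A`, as the least `i` such that `Ext^i(k, A) ≠ 0`. -/
def extDepth (A : Type) [CommRing A] [IsLocalRing A] : ℕ∞ :=
  sInf {n : ℕ∞ | ∃ m : ℕ, n = (m : ℕ∞) ∧
    Nontrivial (((Ext A (ModuleCat A) m).obj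
      (Opposite.op (ModuleCat.of A (ResidueField A)))).obj (ModuleCat.of A A))}

/-- A local ring is Cohen–Macaulay if its depth equals its Krull dimension. -/
def IsCohenMacaulay (A : Type) [CommRing A] [IsLocalRing A] : Prop :=
  (extDepth A : WithBot ℕ∞) = ringKrullDim A

/-- The Cohen–Macaulay type `r(R) = ℓ_R(Ext^d_R(R/𝔪, R))`. -/
def cmType (d : ℕ) : WithBot ℕ∞ :=
  moduleLength R (((Ext R (ModuleCat R) d).obj
      (Opposite.op (ModuleCat.of R (R ⧸ maximalIdeal R)))).obj (ModuleCat.of R R))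

/-- `f` is the sequence of coefficients of the polynomial that agrees with
`n ↦ ℓ((Iⁿ :_R 𝔪)/Iⁿ)` for all large `n`; `f 0` is the irreducible multiplicity `f₀(I)`. -/
def IsIrrCoeffs (d : ℕ) (I : Ideal R) (f : ℕ → ℤ) : Prop :=
  ∃ N : ℕ, ∀ n ≥ N, ∃ L : ℕ,
    indexOfReducibility R (I ^ n) = (L : ℕ∞) ∧
    (L : ℤ) = ∑ i ∈ Finset.range d,
      (-1 : ℤ) ^ i * f i * ((n + (d - 1) - i).choose (d - 1 - i) : ℤ)

/-- `R` is a generalized Cohen–Macaulay ring of dimension `d`: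
the local cohomology modules `H^i_𝔪(R)` have finite length for all `i < d`. -/
def IsGeneralizedCM (d : ℕ) : Prop :=
  ∀ i < d, ∃ L : ℕ,
    moduleLength R ↥((localCohomology (maximalIdeal R) i).obj (ModuleCat.of R R)) = (L : ℕ∞)

/-- `r_i(R) = dim_k ((0) :_{H^i_𝔪(R)} 𝔪)`, the length of the socle of the `i`-th
local cohomology module of `R`. -/
def socLocalCohomology (i : ℕ) : WithBot ℕ∞ :=
  moduleLength R
    ↥(Submodule.torsionBySet R ↥((localCohomology (maximalIdeal R) i).obj (ModuleCat.of R R))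
      (maximalIdeal R : Set R))

/-- A system of parameters `x₁, …, x_d` is standard if
`𝔮·H^i_𝔪(R/(x₁,…,x_j)R) = 0` for all `i + j < d`, where `𝔮 = (x₁,…,x_d)`. -/
def IsStandardSOP (d : ℕ) (x : Fin d → R) : Prop :=
  (Ideal.span (Set.range x)).radical = maximalIdeal R ∧
  ∀ i j : ℕ, i + j < d →
    ∀ a ∈ Ideal.span (Set.range x),
      ∀ v : ((localCohomology (maximalIdeal R) i).obj
        (ModuleCat.of R (R ⧸ Ideal.span (x '' {k : Fin d | (k : ℕ) < j})))), a • v = 0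

/-- `R` is a regular local ring of dimension `d`: `𝔪` is generated by `d` elements. -/
def IsRegularLocal (d : ℕ) : Prop :=
  ∃ x : Fin d → R, maximalIdeal R = Ideal.span (Set.range x)

/-- `R` is Gorenstein: `R` is Cohen–Macaulay of Cohen–Macaulay type `r(R) = 1`. -/
def IsGorenstein (d : ℕ) : Prop :=
  IsCohenMacaulay R ∧ cmType R d = 1

universe u

section ExtClass

open Limits Opposite

variable {A : Type u} [CommRing A] {X : ModuleCat.{u} A}

/-- The cocycles of degree `n` in `Hom(P, Y)`. -/
def extCocycles (P : ProjectiveResolution X) (n : ℕ) (Y : ModuleCat.{u} A) :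
    Submodule A (P.complex.X n ⟶ Y) :=
  LinearMap.ker (Linear.leftComp A Y (P.complex.d (n + 1) n))

lemma mem_extCocycles {P : ProjectiveResolution X} {n : ℕ} {Y : ModuleCat.{u} A}
    {c : P.complex.X n ⟶ Y} : c ∈ extCocycles P n Y ↔ P.complex.d (n + 1) n ≫ c = 0 :=
  LinearMap.mem_ker

/-- The complex `Hom(P, Y)`, seen as a chain complex in the opposite category. -/
abbrev extComplex (P : ProjectiveResolution X) (Y : ModuleCat.{u} A) :
    ChainComplex (ModuleCat.{u} A)ᵒᵖ ℕ :=
  (((linearYoneda A (ModuleCat.{u} A)).obj Y).rightOp.mapHomologicalComplex _).obj P.complex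

/-- The inclusion of cocycles in `Hom(P, Y)`, descended to opcycles of the opposite complex. -/
def extCocyclesDesc (P : ProjectiveResolution X) (n : ℕ) (Y : ModuleCat.{u} A) :
    (extComplex P Y).opcycles n ⟶ op (ModuleCat.of A (extCocycles P n Y)) :=
  (extComplex P Y).descOpcycles (ModuleCat.ofHom (extCocycles P n Y).subtype).op (n + 1)
    (by simp) (by
      apply Quiver.Hom.unop_inj
      ext c
      exact mem_extCocycles.1 c.2)

lemma p_extCocyclesDesc (P : ProjectiveResolution X) (n : ℕ) (Y : ModuleCat.{u} A) :
    (extComplex P Y).pOpcycles n ≫ extCocyclesDesc P n Y =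
      (ModuleCat.ofHom (extCocycles P n Y).subtype).op :=
  (extComplex P Y).p_descOpcycles _ _ _ _

/-- The class in `Extⁿ(X, Y)` of a cocycle in `Hom(P, Y)`. -/
def extClass (P : ProjectiveResolution X) (n : ℕ) (Y : ModuleCat.{u} A) :
    ModuleCat.of A (extCocycles P n Y) ⟶ ((Ext A (ModuleCat.{u} A) n).obj (op X)).obj Y :=
  ((P.isoLeftDerivedObj ((linearYoneda A (ModuleCat.{u} A)).obj Y).rightOp n).hom ≫
    (extComplex P Y).homologyι n ≫ extCocyclesDesc P n Y).unop

lemma pOpcycles_unop_extCocyclesDesc_unop (P : ProjectiveResolution X) (n : ℕ)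
    (Y : ModuleCat.{u} A) (c : extCocycles P n Y) :
    ((extComplex P Y).pOpcycles n).unop ((extCocyclesDesc P n Y).unop c) = c.1 :=
  congrArg (fun f => f.unop c) (p_extCocyclesDesc P n Y)

lemma pOpcycles_unop_injective (P : ProjectiveResolution X) (n : ℕ) (Y : ModuleCat.{u} A) :
    Function.Injective ((extComplex P Y).pOpcycles n).unop :=
  (ModuleCat.mono_iff_injective _).1 inferInstance

lemma pOpcycles_unop_fromOpcycles_unop (P : ProjectiveResolution X) (n m : ℕ)
    (Y : ModuleCat.{u} A) (h : P.complex.X m ⟶ Y) :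
    ((extComplex P Y).pOpcycles n).unop (((extComplex P Y).fromOpcycles n m).unop h) =
      P.complex.d n m ≫ h :=
  congrArg (fun f => f.unop h) ((extComplex P Y).p_fromOpcycles n m)

lemma homologyι_unop_eq_zero_iff (P : ProjectiveResolution X) (n : ℕ) (Y : ModuleCat.{u} A)
    (z : ((extComplex P Y).opcycles n).unop) :
    ((extComplex P Y).homologyι n).unop z = 0 ↔
      ∃ h : P.complex.X ((ComplexShape.down ℕ).next n) ⟶ Y,
        ((extComplex P Y).fromOpcycles n _).unop h = z := by
  have hex := (ShortComplex.exact_of_f_is_kernel (ShortComplex.mk _ _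
    ((extComplex P Y).homologyι_comp_fromOpcycles n ((ComplexShape.down ℕ).next n)))
    ((extComplex P Y).homologyIsKernel n _ rfl)).unop
  rw [ShortComplex.moduleCat_exact_iff] at hex
  refine ⟨fun hz => hex z hz, ?_⟩
  rintro ⟨h, rfl⟩
  exact congrArg (fun f => f.unop h) ((extComplex P Y).homologyι_comp_fromOpcycles n
    ((ComplexShape.down ℕ).next n))

lemma extClass_apply (P : ProjectiveResolution X) (n : ℕ) (Y : ModuleCat.{u} A)
    (c : extCocycles P n Y) :
    extClass P n Y c =
      (P.isoLeftDerivedObj ((linearYoneda A (ModuleCat.{u} A)).obj Y).rightOp n).hom.unop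
        (((extComplex P Y).homologyι n).unop ((extCocyclesDesc P n Y).unop c)) :=
  rfl

lemma extClass_eq_zero_iff (P : ProjectiveResolution X) (n : ℕ) (Y : ModuleCat.{u} A)
    (c : extCocycles P n Y) :
    extClass P n Y c = 0 ↔
      ∃ h : P.complex.X ((ComplexShape.down ℕ).next n) ⟶ Y,
        (c : P.complex.X n ⟶ Y) = P.complex.d n _ ≫ h := by
  have hinj : Function.Injective
      (P.isoLeftDerivedObj ((linearYoneda A (ModuleCat.{u} A)).obj Y).rightOp n).hom.unop :=
    (ModuleCat.mono_iff_injective _).1 inferInstance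
  rw [extClass_apply]
  refine (map_eq_zero_iff _ hinj).trans
    ((homologyι_unop_eq_zero_iff P n Y _).trans (exists_congr fun h => ?_))
  rw [← (pOpcycles_unop_injective P n Y).eq_iff, pOpcycles_unop_fromOpcycles_unop,
    pOpcycles_unop_extCocyclesDesc_unop, eq_comm]
  exact Iff.rfl

lemma extClass_naturality {X' : ModuleCat.{u} A} (f : X' ⟶ X) (P' : ProjectiveResolution X')
    (P : ProjectiveResolution X)
    (φ : P'.complex ⟶ P.complex) (comm : φ.f 0 ≫ P.π.f 0 = P'.π.f 0 ≫ f) (n : ℕ)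
    (Y : ModuleCat.{u} A) (c : extCocycles P n Y) (c' : extCocycles P' n Y)
    (hc : (c' : P'.complex.X n ⟶ Y) = φ.f n ≫ c) :
    ((Ext A (ModuleCat.{u} A) n).map f.op).app Y (extClass P n Y c) =
      extClass P' n Y c' := by
  have hnat := ProjectiveResolution.isoLeftDerivedObj_hom_naturality f P' P φ comm
    ((linearYoneda A (ModuleCat.{u} A)).obj Y).rightOp n
  let Φ : extComplex P' Y ⟶ extComplex P Y :=
    (((linearYoneda A (ModuleCat.{u} A)).obj Y).rightOp.mapHomologicalComplex _).map φ
  have hι := HomologicalComplex.homologyι_naturality Φ n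
  have hp := HomologicalComplex.p_opcyclesMap Φ n
  rw [extClass_apply, extClass_apply]
  have h1 := congrArg (fun f => f.unop
    (((extComplex P Y).homologyι n).unop ((extCocyclesDesc P n Y).unop c))) hnat
  refine h1.trans ?_
  have h2 := congrArg (fun f => f.unop ((extCocyclesDesc P n Y).unop c)) hι
  have h3 := congrArg (fun f => f.unop ((extCocyclesDesc P n Y).unop c)) hp
  refine congrArg
    (P'.isoLeftDerivedObj ((linearYoneda A (ModuleCat.{u} A)).obj Y).rightOp n).hom.unop
    (h2.trans (congrArg ((extComplex P' Y).homologyι n).unop ?_))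
  apply pOpcycles_unop_injective P' n Y
  refine h3.trans ?_
  rw [pOpcycles_unop_extCocyclesDesc_unop, hc]
  exact congrArg (fun c => φ.f n ≫ c) (pOpcycles_unop_extCocyclesDesc_unop P n Y c)

variable {M : Type u} [AddCommGroup M] [Module A M]

/-- The augmentation of a projective resolution, as a linear map. -/
def augmentation (P : ProjectiveResolution (ModuleCat.of A M)) : P.complex.X 0 →ₗ[A] M :=
  (P.π.f 0).hom

lemma augmentation_surjective (P : ProjectiveResolution (ModuleCat.of A M)) :
    Function.Surjective (augmentation P) :=
  (ModuleCat.epi_iff_surjective (P.π.f 0)).1 inferInstance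

lemma augmentation_d (P : ProjectiveResolution (ModuleCat.of A M)) (p : P.complex.X 1) :
    augmentation P (P.complex.d 1 0 p) = 0 :=
  congrArg (fun f => f.hom p) P.complex_d_comp_π_f_zero

lemma exists_d_eq_of_augmentation_eq_zero (P : ProjectiveResolution (ModuleCat.of A M))
    (p : P.complex.X 0) (hp : augmentation P p = 0) : ∃ q, P.complex.d 1 0 q = p :=
  (ShortComplex.moduleCat_exact_iff _).1 P.exact₀ p hp

lemma exists_lift_zero (P : ProjectiveResolution (ModuleCat.of A M)) {N : Type u}
    [AddCommGroup N] [Module A N] (π : N →ₗ[A] M) (hπ : Function.Surjective π) :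
    ∃ φ : P.complex.X 0 →ₗ[A] N, ∀ p, π (φ p) = augmentation P p := by
  have : Module.Projective A (P.complex.X 0) :=
    (IsProjective.iff_projective (P.complex.X 0)).2 (P.projective 0)
  obtain ⟨φ, hφ⟩ := Module.projective_lifting_property π (augmentation P) hπ
  exact ⟨φ, fun p => LinearMap.congr_fun hφ p⟩

lemma augmentation_lift {N : Type u} [AddCommGroup N] [Module A N]
    (P' : ProjectiveResolution (ModuleCat.of A N)) (P : ProjectiveResolution (ModuleCat.of A M))
    (f : N →ₗ[A] M) (p : P'.complex.X 0) :
    augmentation P ((ProjectiveResolution.lift (ModuleCat.ofHom f) P' P).f 0 p) =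
      f (augmentation P' p) :=
  congrArg (fun g => g.hom p) (ProjectiveResolution.lift_commutes_zero (ModuleCat.ofHom f) P' P)

/-- The map induced on `Extⁿ` by the projection `A/J' → A/J`. -/
def extMapQuotient (n : ℕ) {J' J : Ideal A} (h : J' ≤ J) (Y : ModuleCat.{u} A) :
    ((Ext A (ModuleCat.{u} A) n).obj (op (ModuleCat.of A (A ⧸ J)))).obj Y ⟶
      ((Ext A (ModuleCat.{u} A) n).obj (op (ModuleCat.of A (A ⧸ J')))).obj Y :=
  ((Ext A (ModuleCat.{u} A) n).map
    (ModuleCat.ofHom (Submodule.mapQ J' J LinearMap.id h)).op).app Y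

lemma exists_extMapQuotient_extClass (n : ℕ) {J' J : Ideal A} (h : J' ≤ J) {Y : ModuleCat.{u} A}
    (P' : ProjectiveResolution (ModuleCat.of A (A ⧸ J')))
    (P : ProjectiveResolution (ModuleCat.of A (A ⧸ J))) (c : extCocycles P n Y)
    (h0 : extMapQuotient n h Y (extClass P n Y c) = 0) :
    ∃ g : P'.complex.X ((ComplexShape.down ℕ).next n) ⟶ Y,
      (ProjectiveResolution.lift (ModuleCat.ofHom (Submodule.mapQ J' J LinearMap.id h)) P' P).f n ≫
        (c : P.complex.X n ⟶ Y) = P'.complex.d n _ ≫ g := by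
  set φ := ProjectiveResolution.lift (ModuleCat.ofHom (Submodule.mapQ J' J LinearMap.id h)) P' P
  have hc : φ.f n ≫ (c : P.complex.X n ⟶ Y) ∈ extCocycles P' n Y := by
    rw [mem_extCocycles, ← HomologicalComplex.Hom.comm_assoc, mem_extCocycles.1 c.2, comp_zero]
  have := extClass_naturality _ P' P φ (ProjectiveResolution.lift_commutes_zero _ P' P) n Y c
    ⟨_, hc⟩ rfl
  exact (extClass_eq_zero_iff P' n Y ⟨_, hc⟩).1 (this.symm.trans h0)

lemma exists_lift_one_sub_mem {J' J : Ideal A} (h : J' ≤ J)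
    (P' : ProjectiveResolution (ModuleCat.of A (A ⧸ J')))
    (P : ProjectiveResolution (ModuleCat.of A (A ⧸ J)))
    (φ : P.complex.X 0 →ₗ[A] A) (hφ : ∀ p, J.mkQ (φ p) = augmentation P p) :
    ∃ p, augmentation P' p = J'.mkQ 1 ∧
      φ ((ProjectiveResolution.lift (ModuleCat.ofHom (Submodule.mapQ J' J LinearMap.id h))
        P' P).f 0 p) - 1 ∈ J := by
  obtain ⟨p, hp⟩ := augmentation_surjective P' (J'.mkQ 1)
  refine ⟨p, hp, ?_⟩
  rw [← Submodule.Quotient.mk_eq_zero, Submodule.Quotient.mk_sub, sub_eq_zero]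
  refine (hφ _).trans ((augmentation_lift P' P _ p).trans ?_)
  rw [hp]
  rfl

theorem exists_linearMap_ext_zero (J : Ideal A) (Y : ModuleCat.{u} A) :
    ∃ ψ : Submodule.torsionBySet A Y J →ₗ[A]
        ((Ext A (ModuleCat.{u} A) 0).obj (op (ModuleCat.of A (A ⧸ J)))).obj Y,
      ∀ (J' : Ideal A) (h : J' ≤ J) (w : Submodule.torsionBySet A Y J),
        extMapQuotient 0 h Y (ψ w) = 0 → w = 0 := by
  let P := projectiveResolution (ModuleCat.of A (A ⧸ J))
  obtain ⟨φ, hφ⟩ := exists_lift_zero P J.mkQ J.mkQ_surjective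
  have hd : ∀ p, φ (P.complex.d 1 0 p) ∈ J := fun p => by
    rw [← Submodule.Quotient.mk_eq_zero]
    exact (hφ _).trans (augmentation_d P p)
  let cocycle : Submodule.torsionBySet A Y J →ₗ[A] extCocycles P 0 Y :=
    { toFun := fun w => ⟨ModuleCat.ofHom ((LinearMap.toSpanSingleton A Y w.1).comp φ), by
        rw [mem_extCocycles]
        ext p
        exact (Submodule.mem_torsionBySet_iff _ _).1 w.2 ⟨_, hd p⟩⟩
      map_add' := fun w w' => by
        ext p
        exact smul_add _ _ _
      map_smul' := fun a w => by
        ext p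
        exact smul_comm _ _ _ }
  refine ⟨(extClass P 0 Y).hom.comp cocycle, fun J' h w h0 => ?_⟩
  let P' := projectiveResolution (ModuleCat.of A (A ⧸ J'))
  obtain ⟨g, hg⟩ := exists_extMapQuotient_extClass 0 h P' P (cocycle w) h0
  rw [P'.complex.shape 0 _ (by simp), zero_comp] at hg
  obtain ⟨p, -, h3⟩ := exists_lift_one_sub_mem h P' P φ hφ
  have h1 := congrArg (fun f => f.hom p) hg
  set q := (ProjectiveResolution.lift (ModuleCat.ofHom (Submodule.mapQ J' J LinearMap.id h))
    P' P).f 0 p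
  have h2 : φ q • w.1 = 0 := h1
  have h4 : (φ q - 1) • w.1 = 0 :=
    (Submodule.mem_torsionBySet_iff _ _).1 w.2 ⟨_, h3⟩
  rw [sub_smul, h2, one_smul, zero_sub, neg_eq_zero] at h4
  exact Subtype.ext h4

theorem exists_ext_one_class (J : Ideal A) (Y : ModuleCat.{u} A) (f : J →ₗ[A] Y) :
    ∃ e : ((Ext A (ModuleCat.{u} A) 1).obj (op (ModuleCat.of A (A ⧸ J)))).obj Y,
      (∀ (J' : Ideal A) (h : J' ≤ J) (a : A), extMapQuotient 1 h Y (a • e) = 0 →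
        ∃ g : A →ₗ[A] Y, ∀ (j : A) (hj : j ∈ J'), a • f ⟨j, h hj⟩ = g j) ∧
      ∀ (a : A) (g : A →ₗ[A] Y), (∀ j : J, a • f j = g j) → a • e = 0 := by
  let P := projectiveResolution (ModuleCat.of A (A ⧸ J))
  obtain ⟨φ, hφ⟩ := exists_lift_zero P J.mkQ J.mkQ_surjective
  have hd : ∀ p, φ (P.complex.d 1 0 p) ∈ J := fun p => by
    rw [← Submodule.Quotient.mk_eq_zero]
    exact (hφ _).trans (augmentation_d P p)
  let φ₁ : P.complex.X 1 →ₗ[A] J := (φ.comp (P.complex.d 1 0).hom).codRestrict J hd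
  let c : extCocycles P 1 Y := ⟨ModuleCat.ofHom (f.comp φ₁), by
    rw [mem_extCocycles]
    ext p
    have h1 : P.complex.d 1 0 (P.complex.d 2 1 p) = 0 :=
      congrArg (fun f => f.hom p) (P.complex.d_comp_d 2 1 0)
    have h2 : φ₁ (P.complex.d 2 1 p) = 0 :=
      Subtype.ext ((congrArg φ h1).trans (map_zero φ))
    exact (congrArg f h2).trans (map_zero f)⟩
  have hnext : (ComplexShape.down ℕ).next 1 = 0 := by simp
  refine ⟨extClass P 1 Y c, fun J' h a h0 => ?_, fun a g hg => ?_⟩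
  · let P' := projectiveResolution (ModuleCat.of A (A ⧸ J'))
    rw [← map_smul] at h0
    have := exists_extMapQuotient_extClass 1 h P' P (a • c) h0
    rw [hnext] at this
    obtain ⟨g, hg⟩ := this
    obtain ⟨p, hp, hmem⟩ := exists_lift_one_sub_mem h P' P φ hφ
    set Φ := ProjectiveResolution.lift (ModuleCat.ofHom (Submodule.mapQ J' J LinearMap.id h)) P' P
    refine ⟨LinearMap.toSpanSingleton A Y (g p - a • f ⟨_, hmem⟩), fun j hj => ?_⟩
    obtain ⟨r, hr⟩ := exists_d_eq_of_augmentation_eq_zero P' (j • p) (by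
      rw [map_smul, hp, ← map_smul, smul_eq_mul, mul_one]
      exact (Submodule.Quotient.mk_eq_zero J').2 hj)
    have h1 : a • f (φ₁ (Φ.f 1 r)) = g (P'.complex.d 1 0 r) := congrArg (fun f => f.hom r) hg
    have h2 : P.complex.d 1 0 (Φ.f 1 r) = Φ.f 0 (P'.complex.d 1 0 r) :=
      congrArg (fun f => f.hom r) (Φ.comm 1 0)
    have h3 : φ₁ (Φ.f 1 r) = ⟨j, h hj⟩ + j • ⟨_, hmem⟩ := by
      apply Subtype.ext
      refine (congrArg φ h2).trans ?_
      rw [hr, map_smul, map_smul]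
      simp only [Submodule.coe_add, Submodule.coe_smul, smul_eq_mul]
      ring
    rw [h3, hr, map_add, map_smul, map_smul, smul_add] at h1
    rw [LinearMap.toSpanSingleton_apply, smul_sub, ← h1, smul_comm j a]
    abel
  · rw [← map_smul, extClass_eq_zero_iff, hnext]
    refine ⟨ModuleCat.ofHom (g.comp φ), ?_⟩
    ext p
    exact hg (φ₁ p)

open localCohomology in
/-- The canonical map from `Extⁿ(A/Iᵗ, Y)` to local cohomology. -/
def extToLocalCohomology (I : Ideal A) (n t : ℕ) (Y : ModuleCat.{u} A) :
    ((Ext A (ModuleCat.{u} A) n).obj (op (ModuleCat.of A (A ⧸ I ^ t)))).obj Y ⟶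
      (localCohomology I n).obj Y :=
  have := hasColimitDiagram.{u, 0} (idealPowersDiagram I) n
  (colimit.ι (diagram (idealPowersDiagram I) n) (op (op t))).app Y

open localCohomology in
lemma exists_extMapQuotient_eq_zero (I : Ideal A) (n t : ℕ) (Y : ModuleCat.{u} A)
    (e : ((Ext A (ModuleCat.{u} A) n).obj (op (ModuleCat.of A (A ⧸ I ^ t)))).obj Y)
    (he : extToLocalCohomology I n t Y e = 0) :
    ∃ (t' : ℕ) (h : t ≤ t'), extMapQuotient n (Ideal.pow_le_pow_right h) Y e = 0 := by
  have := hasColimitDiagram.{u, 0} (idealPowersDiagram I) n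
  have hiso := colimitObjIsoColimitCompEvaluation_ι_app_hom
    (diagram (idealPowersDiagram I) n) (op (op t)) Y
  have h1 := congrArg (fun f => f.hom e) hiso
  have h0 : colimit.ι (diagram (idealPowersDiagram I) n ⋙ (evaluation _ _).obj Y)
      (op (op t)) e = 0 := by
    refine h1.symm.trans ?_
    refine (congrArg (colimitObjIsoColimitCompEvaluation
      (diagram (idealPowersDiagram I) n) Y).hom he).trans ?_
    exact map_zero _
  have : PreservesFilteredColimitsOfSize.{0, 0} (forget (ModuleCat.{u} A)) :=
    preservesFilteredColimitsOfSize_shrink.{0, u, 0, u} _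
  obtain ⟨j, i, hi⟩ := Concrete.colimit_rep_eq_zero.{u, 0, 0, u} A
    (diagram (idealPowersDiagram I) n ⋙ (evaluation _ _).obj Y) (op (op t)) e h0
  exact ⟨j.unop.unop, i.unop.unop.down.down, hi⟩

theorem exists_injective_torsion_to_localCohomology_zero (I : Ideal A) (t : ℕ)
    (Y : ModuleCat.{u} A) :
    ∃ ψ : Submodule.torsionBySet A Y ((I ^ t : Ideal A) : Set A) →ₗ[A] (localCohomology I 0).obj Y,
      Function.Injective ψ := by
  obtain ⟨ψ, hψ⟩ := exists_linearMap_ext_zero (I ^ t) Y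
  refine ⟨(extToLocalCohomology I 0 t Y).hom.comp ψ, ?_⟩
  rw [injective_iff_map_eq_zero]
  intro w hw
  obtain ⟨t', h, h0⟩ := exists_extMapQuotient_eq_zero I 0 t Y (ψ w) hw
  exact hψ _ _ w h0

theorem exists_localCohomology_one_class (I : Ideal A) (t : ℕ) (Y : ModuleCat.{u} A)
    (f : (I ^ t : Ideal A) →ₗ[A] Y) :
    ∃ e : (localCohomology I 1).obj Y,
      (∀ a : A, a • e = 0 → ∃ (t' : ℕ) (h : I ^ t' ≤ I ^ t) (y : Y),
        ∀ (j : A) (hj : j ∈ I ^ t'), a • f ⟨j, h hj⟩ = j • y) ∧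
      ∀ (a : A) (y : Y), (∀ j : (I ^ t : Ideal A), a • f j = (j : A) • y) → a • e = 0 := by
  obtain ⟨e, he, he'⟩ := exists_ext_one_class (I ^ t) Y f
  refine ⟨extToLocalCohomology I 1 t Y e, fun a ha => ?_, fun a y hy => ?_⟩
  · rw [← map_smul] at ha
    obtain ⟨t', h, h0⟩ := exists_extMapQuotient_eq_zero I 1 t Y _ ha
    obtain ⟨g, hg⟩ := he _ _ a h0
    refine ⟨t', Ideal.pow_le_pow_right h, g 1, fun j hj => ?_⟩
    rw [hg j hj, ← map_smul, smul_eq_mul, mul_one]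
  · rw [← map_smul, he' a (LinearMap.toSpanSingleton A Y y) hy, map_zero]

end ExtClass

section DimensionOne

variable {A : Type u} [CommRing A]

lemma mul_eq_zero_of_pow_mul_eq_zero {x : A} (hx : ∀ w, x ^ 2 * w = 0 → x * w = 0) (n : ℕ) {w : A}
    (hw : x ^ (n + 1) * w = 0) : x * w = 0 := by
  induction n with
  | zero => simpa using hw
  | succ n ih =>
    refine ih ?_
    have := hx (x ^ n * w) (by rw [← hw]; ring)
    rw [← this]; ring

lemma exists_linearMap_of_le_span_sq {x : A} (hx : ∀ w, x ^ 2 * w = 0 → x * w = 0) {J : Ideal A}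
    (hJ : J ≤ Ideal.span {x ^ 2}) :
    ∃ f : J →ₗ[A] A, ∀ (j : J) (r : A), (j : A) = x ^ 2 * r → f j = x * r := by
  have h : ∀ j : J, ∃ r, (j : A) = x ^ 2 * r := fun j => Ideal.mem_span_singleton.1 (hJ j.2)
  choose r hr using h
  have hspec : ∀ (j : J) (s : A), (j : A) = x ^ 2 * s → x * r j = x * s := fun j s hs => by
    rw [← sub_eq_zero, ← mul_sub]
    apply hx
    rw [mul_sub, ← hr, ← hs, sub_self]
  refine ⟨{ toFun := fun j => x * r j, map_add' := fun j k => ?_, map_smul' := fun a j => ?_ },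
    hspec⟩
  · rw [hspec (j + k) (r j + r k) (by rw [Submodule.coe_add, hr j, hr k, mul_add]), mul_add]
  · rw [hspec (a • j) (a * r j) (by rw [Submodule.coe_smul, hr j, smul_eq_mul]; ring),
      RingHom.id_apply, smul_eq_mul]
    ring

theorem exists_localCohomology_one_smul_eq_zero_iff {I : Ideal A} {x : A} (hxI : x ∈ I)
    (hx : ∀ w, x ^ 2 * w = 0 → x * w = 0) {t : ℕ} (ht : I ^ t ≤ Ideal.span {x ^ 2}) :
    ∃ e : (localCohomology I 1).obj (ModuleCat.of A A),
      ∀ a : A, a • e = 0 ↔ ∃ b, x * (a - x * b) = 0 := by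
  obtain ⟨f, hf⟩ := exists_linearMap_of_le_span_sq hx ht
  obtain ⟨e, he, he'⟩ := exists_localCohomology_one_class I t (ModuleCat.of A A) f
  refine ⟨e, fun a => ⟨fun ha => ?_, fun ⟨b, hb⟩ => he' a b fun j => ?_⟩⟩
  · obtain ⟨t', h, b, hb⟩ := he a ha
    have hmem : x ^ (t' + 2) ∈ I ^ t' :=
      Ideal.pow_le_pow_right (Nat.le_add_right t' 2) (Ideal.pow_mem_pow hxI _)
    have h1 : a * f ⟨_, h hmem⟩ = x ^ (t' + 2) * b := hb _ hmem
    rw [hf ⟨_, h hmem⟩ (x ^ t') (by ring)] at h1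
    refine ⟨b, mul_eq_zero_of_pow_mul_eq_zero hx t' ?_⟩
    linear_combination h1
  · obtain ⟨r, hr⟩ := Ideal.mem_span_singleton.1 (ht j.2)
    rw [hf j r hr]
    change a * (x * r) = j * b
    rw [hr]
    linear_combination r * hb

/-- The ideal `xA + (0 :_A x)`. -/
def spanAddAnnihilator (x : A) : Ideal A :=
  Ideal.span {x} ⊔ (⊥ : Ideal A).colon {x}

lemma mem_spanAddAnnihilator {x a : A} :
    a ∈ spanAddAnnihilator x ↔ ∃ b, x * (a - x * b) = 0 := by
  simp only [spanAddAnnihilator, Submodule.mem_sup, Ideal.mem_span_singleton,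
    Submodule.mem_colon_singleton, smul_eq_mul, Ideal.mem_bot]
  constructor
  · rintro ⟨_, ⟨b, rfl⟩, z, hz, rfl⟩
    exact ⟨b, by linear_combination hz⟩
  · rintro ⟨b, hb⟩
    exact ⟨x * b, ⟨b, rfl⟩, a - x * b, by linear_combination hb, by ring⟩

theorem length_colon_le_socle_localCohomology_one {I : Ideal A} {x : A} (hxI : x ∈ I)
    (hx : ∀ w, x ^ 2 * w = 0 → x * w = 0) {t : ℕ} (ht : I ^ t ≤ Ideal.span {x ^ 2}) :
    Module.length A (↥((spanAddAnnihilator x).colon (I : Set A)) ⧸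
        Submodule.comap ((spanAddAnnihilator x).colon (I : Set A)).subtype
          (spanAddAnnihilator x)) ≤
      Module.length A (Submodule.torsionBySet A
        ((localCohomology I 1).obj (ModuleCat.of A A)) (I : Set A)) := by
  obtain ⟨e, he⟩ := exists_localCohomology_one_smul_eq_zero_iff hxI hx ht
  have he' : ∀ a, a • e = 0 ↔ a ∈ spanAddAnnihilator x := fun a =>
    (he a).trans mem_spanAddAnnihilator.symm
  let g : (spanAddAnnihilator x).colon (I : Set A) →ₗ[A] Submodule.torsionBySet A
      ((localCohomology I 1).obj (ModuleCat.of A A)) (I : Set A) :=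
    ((LinearMap.toSpanSingleton A _ e).comp (Submodule.subtype _)).codRestrict _ fun a => by
      rw [Submodule.mem_torsionBySet_iff]
      intro i
      change (i : A) • (a : A) • e = 0
      rw [smul_smul, he', mul_comm]
      exact Submodule.mem_colon.1 a.2 i i.2
  have hker : LinearMap.ker g =
      Submodule.comap ((spanAddAnnihilator x).colon (I : Set A)).subtype
          (spanAddAnnihilator x) := by
    ext a
    rw [LinearMap.mem_ker, Submodule.mem_comap, Submodule.subtype_apply, ← he']
    exact Subtype.ext_iff
  rw [← hker]
  exact Module.length_le_of_injective _
    (LinearMap.ker_eq_bot.1 (Submodule.ker_liftQ_eq_bot' _ g rfl))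

theorem length_torsion_le_socle_localCohomology_zero (I : Ideal A) (Y : ModuleCat.{u} A) :
    Module.length A (Submodule.torsionBySet A Y (I : Set A)) ≤
      Module.length A (Submodule.torsionBySet A ((localCohomology I 0).obj Y) (I : Set A)) := by
  have h := exists_injective_torsion_to_localCohomology_zero I 1 Y
  rw [pow_one] at h
  obtain ⟨ψ, hψ⟩ := h
  refine Module.length_le_of_injective (ψ.codRestrict _ fun w => ?_) fun w w' h =>
    hψ (congrArg Subtype.val h)
  rw [Submodule.mem_torsionBySet_iff]
  intro i
  rw [← map_smul]
  refine (congrArg ψ ?_).trans (map_zero ψ)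
  exact Subtype.ext ((Submodule.mem_torsionBySet_iff _ _).1 w.2 i)

lemma length_quotient_colon_ne_top [IsLocalRing A] [IsNoetherianRing A] {q : Ideal A}
    (hq : q.radical = maximalIdeal A) (J : Ideal A) :
    Module.length A (J ⧸ Submodule.comap J.subtype q) ≠ ⊤ := by
  have : IsArtinianRing (A ⧸ q) :=
    IsLocalRing.quotient_artinian_of_mem_minimalPrimes_of_isLocalRing q (by
      rw [← Ideal.radical_minimalPrimes, hq,
        Ideal.minimalPrimes_eq_subsingleton_self]
      rfl)
  have : IsArtinian A (A ⧸ q) :=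
    isArtinian_of_surjective_algebraMap (Ideal.Quotient.mk_surjective (I := q))
  have hinj : Function.Injective
      (Submodule.mapQ (Submodule.comap J.subtype q) q J.subtype le_rfl) :=
    LinearMap.ker_eq_bot.1 (by
      rw [Submodule.mapQ, Submodule.ker_liftQ_eq_bot']
      rw [LinearMap.ker_comp, Submodule.ker_mkQ])
  have := isArtinian_of_injective _ hinj
  exact Module.length_ne_top

lemma exists_sub_mem_colon_of_length_le {I : Ideal A} {x : A}
    (hx : ∀ w, x ^ 2 * w = 0 → x * w = 0)
    (hT : Module.length A (Submodule.torsionBySet A A (I : Set A)) ≠ ⊤)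
    (hS : Module.length A (↥((spanAddAnnihilator x).colon (I : Set A)) ⧸
      Submodule.comap ((spanAddAnnihilator x).colon (I : Set A)).subtype
        (spanAddAnnihilator x)) ≠ ⊤)
    (hlen : Module.length A (Submodule.torsionBySet A A (I : Set A)) +
      Module.length A (↥((spanAddAnnihilator x).colon (I : Set A)) ⧸
        Submodule.comap ((spanAddAnnihilator x).colon (I : Set A)).subtype
          (spanAddAnnihilator x)) ≤
      Module.length A (↥((Ideal.span {x}).colon (I : Set A)) ⧸
        Submodule.comap ((Ideal.span {x}).colon (I : Set A)).subtype (Ideal.span {x})))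
    {z : A} (hz : z ∈ (spanAddAnnihilator x).colon (I : Set A)) :
    ∃ z' ∈ (Ideal.span {x}).colon (I : Set A), x * (z - z') = 0 := by
  set q := Ideal.span {x}
  set N := q.colon (I : Set A)
  set S := (spanAddAnnihilator x).colon (I : Set A)
  have hqI : q ≤ spanAddAnnihilator x := le_sup_left
  have hNS : N ≤ S := Submodule.colon_mono hqI subset_rfl
  let θ : (N ⧸ Submodule.comap N.subtype q) →ₗ[A]
      (S ⧸ Submodule.comap S.subtype (spanAddAnnihilator x)) :=
    Submodule.mapQ _ _ (Submodule.inclusion hNS) fun a ha => hqI ha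
  let T := Submodule.torsionBySet A A (I : Set A)
  have hTN : ∀ w : T, (w : A) ∈ N := fun w => Submodule.mem_colon.2 fun i hi => by
    have h : i * (w : A) = 0 := (Submodule.mem_torsionBySet_iff _ _).1 w.2 ⟨i, hi⟩
    rw [smul_eq_mul, mul_comm, h]
    exact q.zero_mem
  let f : T →ₗ[A] (N ⧸ Submodule.comap N.subtype q) :=
    (Submodule.mkQ _).comp (T.subtype.codRestrict N hTN)
  have hker : LinearMap.ker θ ≤ LinearMap.range f := by
    intro v hv
    obtain ⟨⟨a, ha⟩, rfl⟩ := Submodule.mkQ_surjective _ v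
    have ha0 : a ∈ spanAddAnnihilator x := 
      (Submodule.Quotient.mk_eq_zero (Submodule.comap S.subtype (spanAddAnnihilator x))).1 hv
    obtain ⟨b, hb⟩ := mem_spanAddAnnihilator.1 ha0
    refine ⟨⟨a - x * b, (Submodule.mem_torsionBySet_iff _ _).2 fun i => ?_⟩, ?_⟩
    · obtain ⟨d, hd⟩ := Ideal.mem_span_singleton.1 (Submodule.mem_colon.1 ha i i.2)
      rw [smul_eq_mul] at hd
      change (i : A) * (a - x * b) = 0
      have h1 : x * (d - i * b) = 0 := hx _ (by linear_combination (i : A) * hb - x * hd)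
      linear_combination hd + h1
    · refine (Submodule.Quotient.eq _).2 ?_
      change a - x * b - a ∈ q
      exact Ideal.mem_span_singleton.2 ⟨-b, by ring⟩
  have h1 : Module.length A (LinearMap.ker θ) ≤ Module.length A T :=
    (Module.length_le_of_injective _ (Submodule.inclusion_injective hker)).trans
      (Module.length_le_of_surjective _ f.surjective_rangeRestrict)
  have h2 := Module.length_eq_add_of_exact (LinearMap.ker θ).subtype θ.rangeRestrict
    (Submodule.subtype_injective _) θ.surjective_rangeRestrict (LinearMap.exact_iff.2 (by simp))
  have h3 := (hlen.trans_eq h2).trans (add_le_add_left h1 _)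
  rw [ENat.add_le_add_iff_left hT] at h3
  obtain ⟨_, _⟩ := isFiniteLength_iff_isNoetherian_isArtinian.1 (Module.length_ne_top_iff.1 hS)
  have htop : LinearMap.range θ = ⊤ := by
    by_contra h
    exact (Submodule.length_lt h).not_ge h3
  obtain ⟨v, hv⟩ := LinearMap.range_eq_top.1 htop (Submodule.mkQ _ ⟨z, hz⟩)
  obtain ⟨⟨a, ha⟩, rfl⟩ := Submodule.mkQ_surjective _ v
  have hmem : a - z ∈ spanAddAnnihilator x :=
    (Submodule.Quotient.eq (Submodule.comap S.subtype (spanAddAnnihilator x))).1 hv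
  obtain ⟨b, hb⟩ := mem_spanAddAnnihilator.1 hmem
  refine ⟨a - x * b, sub_mem ha (Submodule.mem_colon.2 fun i _ => ?_), ?_⟩
  · exact Ideal.mem_span_singleton.2 ⟨b * i, by rw [smul_eq_mul]; ring⟩
  · linear_combination -hb

lemma span_pow_succ_colon_eq {I : Ideal A} {x : A} (hxI : x ∈ I)
    (hx : ∀ w, x ^ 2 * w = 0 → x * w = 0)
    (h : ∀ z ∈ (spanAddAnnihilator x).colon (I : Set A),
      ∃ z' ∈ (Ideal.span {x}).colon (I : Set A), x * (z - z') = 0) (n : ℕ) :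
    (Ideal.span {x} ^ (n + 1)).colon (I : Set A) =
      Ideal.span {x} ^ n * (Ideal.span {x}).colon (I : Set A) + (⊥ : Ideal A).colon (I : Set A) := by
  apply le_antisymm
  · obtain _ | n := n
    · simp
    intro y hy
    have hy' : ∀ p ∈ I, ∃ d, y * p = x ^ (n + 2) * d := fun p hp => by
      have := Submodule.mem_colon.1 hy p hp
      rwa [Ideal.span_singleton_pow, Ideal.mem_span_singleton] at this
    obtain ⟨z, hz⟩ := hy' x hxI
    obtain ⟨z', hz', hzz⟩ := h z (Submodule.mem_colon.2 fun p hp => by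
      obtain ⟨d, hd⟩ := hy' p hp
      refine mem_spanAddAnnihilator.2 ⟨d, mul_eq_zero_of_pow_mul_eq_zero hx (n + 1) ?_⟩
      rw [smul_eq_mul]
      linear_combination x * hd - p * hz)
    have hyz : y = x ^ (n + 1) * z' + (y - x ^ (n + 1) * z') := by ring
    rw [hyz]
    refine Submodule.add_mem_sup ?_ (Submodule.mem_colon.2 fun p hp => ?_)
    · rw [Ideal.span_singleton_pow]
      exact Ideal.mul_mem_mul (Ideal.mem_span_singleton_self _) hz'
    · obtain ⟨d, hd⟩ := hy' p hp
      obtain ⟨c, hc⟩ := Ideal.mem_span_singleton.1 (Submodule.mem_colon.1 hz' p hp)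
      rw [smul_eq_mul] at hc
      have h1 : x ^ (n + 2 + 1) * (d - c) = 0 := by
        linear_combination -x * hd + p * hz + x ^ (n + 1) * p * hzz + x ^ (n + 2) * hc
      have h2 := mul_eq_zero_of_pow_mul_eq_zero hx _ h1
      rw [smul_eq_mul, Ideal.mem_bot]
      linear_combination hd - x ^ (n + 1) * hc + x ^ (n + 1) * h2
  · refine sup_le (Ideal.mul_le.2 fun a ha z hz => Submodule.mem_colon.2 fun p hp => ?_)
      (Submodule.colon_mono bot_le subset_rfl)
    rw [pow_succ, smul_eq_mul, mul_assoc]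
    exact Ideal.mul_mem_mul ha (Submodule.mem_colon.1 hz p hp)

end DimensionOne

variable {R} in
lemma IsStandardSOP.mul_eq_zero_of_sq_mul_eq_zero {x : R}
    (hx : IsStandardSOP R 1 (fun _ : Fin 1 => x)) {t : ℕ}
    (ht : maximalIdeal R ^ t ≤ Ideal.span {x ^ 2}) {w : R} (hw : x ^ 2 * w = 0) : x * w = 0 := by
  set J := Ideal.span ((fun _ : Fin 1 => x) '' {k : Fin 1 | (k : ℕ) < 0})
  have hJ : J = ⊥ := by simp [J]
  obtain ⟨ψ, hψ⟩ := exists_injective_torsion_to_localCohomology_zero (maximalIdeal R) t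
    (ModuleCat.of R (R ⧸ J))
  have hmem : (J.mkQ w : R ⧸ J) ∈ Submodule.torsionBySet R (R ⧸ J)
      ((maximalIdeal R ^ t : Ideal R) : Set R) := by
    rw [Submodule.mem_torsionBySet_iff]
    intro a
    obtain ⟨b, hb⟩ := Ideal.mem_span_singleton.1 (ht a.2)
    have h : (a : R) * w = 0 := by rw [hb]; linear_combination b * hw
    change (a : R) • J.mkQ w = 0
    rw [← map_smul, smul_eq_mul, h, map_zero]
  have h0 := hx.2 0 0 zero_lt_one x (Ideal.subset_span ⟨0, rfl⟩) (ψ ⟨_, hmem⟩)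
  rw [← map_smul, map_eq_zero_iff ψ hψ] at h0
  have h1 : x • J.mkQ w = 0 := congrArg Subtype.val h0
  rw [← map_smul, Submodule.mkQ_apply, Submodule.Quotient.mk_eq_zero, hJ] at h1
  exact h1

/-- Step of Lemma 4.1: let `R` be a Noetherian local ring of dimension one and `𝔮 = (x)` a
standard parameter ideal with `𝒩(𝔮;R) = r₀(R) + r₁(R)`. Then
`𝔮ⁿ⁺¹ :_R 𝔪 = 𝔮ⁿ(𝔮 :_R 𝔪) + ((0) :_R 𝔪)` for all `n ≥ 0`. -/
theorem stmt_12 [IsNoetherianRing R]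
    (hdim : ringKrullDim R = (1 : WithBot ℕ∞))
    (x : R) (hstd : IsStandardSOP R 1 (fun _ : Fin 1 => x))
    (q : Ideal R) (hq : q = Ideal.span (Set.range fun _ : Fin 1 => x))
    (hN : indexOfReducibility R q = socLocalCohomology R 0 + socLocalCohomology R 1) :
    ∀ n : ℕ, (q ^ (n + 1)).colon (maximalIdeal R) =
      q ^ n * (q.colon (maximalIdeal R)) + (⊥ : Ideal R).colon (maximalIdeal R) := by
  rw [Set.range_const] at hq
  subst hq
  have hrad : (Ideal.span {x}).radical = maximalIdeal R := by
    have := hstd.1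
    rwa [Set.range_const] at this
  have hxm : x ∈ maximalIdeal R := hrad ▸ Ideal.le_radical (Ideal.mem_span_singleton_self x)
  obtain ⟨t, ht⟩ : ∃ t, maximalIdeal R ^ t ≤ Ideal.span {x ^ 2} :=
    Ideal.exists_pow_le_of_le_radical_of_fg
      (by rw [← Ideal.span_singleton_pow, Ideal.radical_pow _ two_ne_zero, hrad])
      (IsNoetherian.noetherian _)
  have hx : ∀ w, x ^ 2 * w = 0 → x * w = 0 := fun w hw => hstd.mul_eq_zero_of_sq_mul_eq_zero ht hw
  have h0 := length_torsion_le_socle_localCohomology_zero (maximalIdeal R) (ModuleCat.of R R)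
  have h1 := length_colon_le_socle_localCohomology_one hxm hx ht
  have hfin := length_quotient_colon_ne_top hrad
    ((Ideal.span {x}).colon (maximalIdeal R : Set R))
  rw [indexOfReducibility, socLocalCohomology, socLocalCohomology, moduleLength, moduleLength,
    moduleLength, ← Module.coe_length, ← Module.coe_length, ← Module.coe_length, ← WithBot.coe_add,
    WithBot.coe_inj] at hN
  have hlen := (add_le_add h0 h1).trans_eq hN.symm
  have htop := ne_top_of_le_ne_top hfin hlen
  exact span_pow_succ_colon_eq hxm hx
    fun z hz => exists_sub_mem_colon_of_length_le hx (ne_top_of_le_ne_top htop le_self_add)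
      (ne_top_of_le_ne_top htop le_add_self) hlen hz

end
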